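/- Let D be a regular 𝓓-class of IG(E), let r ∈ D and e ∈ E, and suppose r·ē ∈ D. Then r·ē 𝓡 r. Moreover, for every s ∈ D with s 𝓛 r, we also have s·ē ∈ D, s·ē 𝓡 s, and s·ē 𝓛 r·ē. -/

import Mathlib

section Green

variable {T : Type*} [Semigroup T]

/-- Green's relation 𝓡. -/
def GreenR (a b : T) : Prop := a = b ∨ ∃ x y : T, a * x = b ∧ b * y = a

/-- Green's relation 𝓛. -/
def GreenL (a b : T) : Prop := a = b ∨ ∃ x y : T, x * a = b ∧ y * b = a

/-- Green's relation 𝓓 = 𝓡 ∘ 𝓛. -/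
def GreenD (a b : T) : Prop := ∃ c : T, GreenR a c ∧ GreenL c b

/-- An element is regular if `a = a * b * a` for some `b`. -/
def IsRegularElem (a : T) : Prop := ∃ b : T, a * b * a = a

/-- The principal two-sided ideal `T¹ a T¹`. -/
def principalIdeal (a : T) : Set T :=
  {x | x = a ∨ (∃ u, u * a = x) ∨ (∃ v, a * v = x) ∨ ∃ u v, u * a * v = x}

/-- Green's relation 𝓙. -/
def GreenJ (a b : T) : Prop := principalIdeal a = principalIdeal b

/-- The 𝓙-preorder. -/
def JleRel (a b : T) : Prop := principalIdeal a ⊆ principalIdeal b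

/-- Strict 𝓙-order. -/
def JltRel (a b : T) : Prop := JleRel a b ∧ ¬ JleRel b a

/-- `u` is a (two-sided) identity element. -/
def IsIdentityElem (u : T) : Prop := ∀ x : T, u * x = x ∧ x * u = x

/-- The relation 𝓡̃. -/
def RTilde (a b : T) : Prop := ∀ ε : T, ε * ε = ε → (ε * a = a ↔ ε * b = b)

/-- The relation 𝓛̃. -/
def LTilde (a b : T) : Prop := ∀ ε : T, ε * ε = ε → (a * ε = a ↔ b * ε = b)

/-- `blockProd p i k = p i * p (i+1) * ⋯ * p (i+k)`. -/
def blockProd (p : ℕ → T) (i : ℕ) : ℕ → T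
  | 0 => p i
  | k + 1 => blockProd p i k * p (i + (k + 1))

/-- Multiply `x` by optional (possibly empty) words on both sides. -/
def withCtx (u : Option T) (x : T) (v : Option T) : T :=
  match u, v with
  | none, none => x
  | some u', none => u' * x
  | none, some v' => x * v'
  | some u', some v' => u' * x * v'

/-- Multiply by an optional word on the left. -/
def leftCtx (u : Option T) (x : T) : T := match u with | none => x | some u' => u' * x

/-- Multiply by an optional word on the right. -/
def rightCtx (x : T) (v : Option T) : T := match v with | none => x | some v' => x * v'

end Green

section IGdef

/-- The set of idempotents of `S`. -/
abbrev IdemE (S : Type*) [Semigroup S] : Type _ := {x : S // x * x = x}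

variable {S : Type*} [Semigroup S]

/-- `e, f` form a basic pair if `{e,f} ∩ {ef,fe} ≠ ∅`. -/
def BasicPair (e f : IdemE S) : Prop :=
  (e : S) * f = e ∨ (e : S) * f = f ∨ (f : S) * e = e ∨ (f : S) * e = f

/-- The defining relations of IG(E): `ef = g` whenever `e, f` is a basic pair with
product `g` in `S`. -/
def igRelBase (u v : FreeSemigroup (IdemE S)) : Prop :=
  ∃ e f g : IdemE S, BasicPair e f ∧ (g : S) = (e : S) * (f : S) ∧
    u = FreeSemigroup.of e * FreeSemigroup.of f ∧ v = FreeSemigroup.of g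

/-- The congruence on the free semigroup `E⁺` generated by the defining relations. -/
def igCon (S : Type*) [Semigroup S] : Con (FreeSemigroup (IdemE S)) :=
  conGen (fun u v => igRelBase u v)

/-- The free idempotent generated semigroup IG(E). -/
abbrev IG (S : Type*) [Semigroup S] := (igCon S).Quotient

/-- `w̄`, the image of a word `w ∈ E⁺` in IG(E). -/
def igBar (w : FreeSemigroup (IdemE S)) : IG S := (w : (igCon S).Quotient)

/-- The list of letters of a word. -/
def wordList (w : FreeSemigroup (IdemE S)) : List (IdemE S) := w.head :: w.tail

/-- The length of a word. -/
def wlen (w : FreeSemigroup (IdemE S)) : ℕ := (wordList w).length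

/-- Length of an optional word. -/
def olen (u : Option (FreeSemigroup (IdemE S))) : ℕ :=
  match u with | none => 0 | some u' => wlen u'

/-- `p 1, …, p m` is an r-factorisation of `w`: each factor represents a regular
element of IG(E). -/
def IsRFact (w : FreeSemigroup (IdemE S)) (m : ℕ) (p : ℕ → FreeSemigroup (IdemE S)) : Prop :=
  1 ≤ m ∧ blockProd p 1 (m - 1) = w ∧ ∀ i, 1 ≤ i → i ≤ m → IsRegularElem (igBar (p i))

/-- A minimal r-factorisation: no product of two or more consecutive factors is regular. -/
def IsMinRFact (w : FreeSemigroup (IdemE S)) (m : ℕ) (p : ℕ → FreeSemigroup (IdemE S)) : Prop :=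
  IsRFact w m p ∧
    ∀ i j, 1 ≤ i → i < j → j ≤ m → ¬ IsRegularElem (igBar (blockProd p i (j - i)))

/-- The relation ≈ on m-tuples of words. -/
def TupleApprox (m : ℕ) (p q : ℕ → FreeSemigroup (IdemE S)) : Prop :=
  (∃ i, 1 ≤ i ∧ i ≤ m ∧ igBar (p i) = igBar (q i) ∧
    ∀ j, 1 ≤ j → j ≤ m → j ≠ i → p j = q j) ∨
  (∃ i, ∃ e : IdemE S, 1 ≤ i ∧ i < m ∧
    igBar (p i) = igBar (q i * FreeSemigroup.of e) ∧
    igBar (q (i + 1)) = igBar (FreeSemigroup.of e * p (i + 1)) ∧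
    ∀ j, 1 ≤ j → j ≤ m → j ≠ i → j ≠ i + 1 → p j = q j) ∨
  (∃ i, ∃ e : IdemE S, 1 ≤ i ∧ i < m ∧
    igBar (q i) = igBar (p i * FreeSemigroup.of e) ∧
    igBar (p (i + 1)) = igBar (FreeSemigroup.of e * q (i + 1)) ∧
    ∀ j, 1 ≤ j → j ≤ m → j ≠ i → j ≠ i + 1 → p j = q j)

/-- The relation ∼: the transitive closure of ≈. -/
def TupleSim (m : ℕ) (p q : ℕ → FreeSemigroup (IdemE S)) : Prop :=
  Relation.TransGen (TupleApprox m) p q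

/-- One application of a defining relation of IG(E) inside a word. -/
def RewriteStep (w w' : FreeSemigroup (IdemE S)) : Prop :=
  ∃ (u v : Option (FreeSemigroup (IdemE S))) (x y : FreeSemigroup (IdemE S)),
    (igRelBase x y ∨ igRelBase y x) ∧ w = withCtx u x v ∧ w' = withCtx u y v

/-- `e` is a seed of `w` at (1-based) position `k`. -/
def SeedAt (w : FreeSemigroup (IdemE S)) (e : IdemE S) (k : ℕ) : Prop :=
  ∃ u v : Option (FreeSemigroup (IdemE S)),
    w = withCtx u (FreeSemigroup.of e) v ∧ k = olen u + 1 ∧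
    GreenL (igBar (leftCtx u (FreeSemigroup.of e))) (igBar (FreeSemigroup.of e)) ∧
    GreenR (igBar (FreeSemigroup.of e)) (igBar (rightCtx (FreeSemigroup.of e) v))

/-- The coordinate (position within `w` of the first letter) of the `i`-th factor. -/
def wcoord (p : ℕ → FreeSemigroup (IdemE S)) (i : ℕ) : ℕ :=
  1 + ∑ j ∈ Finset.Ico 1 i, wlen (p j)

end IGdef

section GreenLemmas

variable {T : Type*} [Semigroup T]

theorem GreenR.symm {a b : T} (h : GreenR a b) : GreenR b a := by
  rcases h with rfl | ⟨x, y, hx, hy⟩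
  · exact Or.inl rfl
  · exact Or.inr ⟨y, x, hy, hx⟩

theorem GreenR.trans {a b c : T} (h : GreenR a b) (h' : GreenR b c) : GreenR a c := by
  rcases h with rfl | ⟨x, y, hx, hy⟩
  · exact h'
  rcases h' with rfl | ⟨x', y', hx', hy'⟩
  · exact Or.inr ⟨x, y, hx, hy⟩
  · exact Or.inr ⟨x * x', y' * y, by rw [← mul_assoc, hx, hx'], by rw [← mul_assoc, hy', hy]⟩

theorem GreenR.mul_left {a b : T} (h : GreenR a b) (c : T) : GreenR (c * a) (c * b) := by
  rcases h with rfl | ⟨x, y, hx, hy⟩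
  · exact Or.inl rfl
  · exact Or.inr ⟨x, y, by rw [mul_assoc, hx], by rw [mul_assoc, hy]⟩

theorem GreenL.mul_right {a b : T} (h : GreenL a b) (c : T) : GreenL (a * c) (b * c) := by
  rcases h with rfl | ⟨x, y, hx, hy⟩
  · exact Or.inl rfl
  · exact Or.inr ⟨x, y, by rw [← mul_assoc, hx], by rw [← mul_assoc, hy]⟩

theorem GreenL.symm {a b : T} (h : GreenL a b) : GreenL b a := by
  rcases h with rfl | ⟨x, y, hx, hy⟩
  · exact Or.inl rfl
  · exact Or.inr ⟨y, x, hy, hx⟩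

theorem IsRegularElem.of_greenD_idempotent {a ε : T} (hε : ε * ε = ε) (h : GreenD a ε) :
    IsRegularElem a := by
  obtain ⟨c, hac, hcε⟩ := h
  have hc : IsRegularElem c := by
    rcases hcε with rfl | ⟨x, y, hx, hy⟩
    · exact ⟨c, by rw [hε, hε]⟩
    · exact ⟨x, by rw [mul_assoc, hx, ← hy, mul_assoc, hε]⟩
  obtain ⟨d, hd⟩ := hc
  rcases hac with rfl | ⟨x, y, hx, hy⟩
  · exact ⟨d, hd⟩
  · refine ⟨x * d, ?_⟩
    calc a * (x * d) * a = (a * x) * d * a := by simp only [mul_assoc]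
      _ = c * d * (c * y) := by rw [hx, hy]
      _ = a := by rw [← mul_assoc, hd, hy]

/-- A semigroup with finitely many idempotents is directly finite at each idempotent. -/
theorem mul_eq_idempotent_comm [Finite (IdemE T)] {e X Y : T}
    (he : e * e = e) (hXe : X * e = X) (heY : e * Y = Y)
    (hXY : X * Y = e) : Y * X = e := by
  let i : ℕ → T := fun n => Nat.rec e (fun _ t => Y * t * X) n
  have i0 : i 0 = e := rfl
  have is : ∀ n, i (n + 1) = Y * i n * X := fun _ => rfl
  have hei : ∀ n, e * i n = i n := by
    rintro (_ | n)
    · exact he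
    · rw [is, ← mul_assoc, ← mul_assoc, heY]
  have hie : ∀ n, i n * e = i n := by
    rintro (_ | n)
    · exact he
    · rw [is, mul_assoc, hXe]
  have hidem : ∀ n, i n * i n = i n := by
    intro n
    induction n with
    | zero => exact he
    | succ n ih =>
      calc i (n + 1) * i (n + 1) = Y * (i n * ((X * Y) * i n)) * X := by
            simp only [is, mul_assoc]
        _ = i (n + 1) := by rw [hXY, hei, ih, is]
  have hpeel : ∀ n, X * i (n + 1) * Y = i n := by
    intro n
    calc X * i (n + 1) * Y = (X * Y) * i n * (X * Y) := by simp only [is, mul_assoc]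
      _ = i n := by rw [hXY, hei, hie]
  have hne : ∀ n k, i n = i (n + (k + 1)) → i 0 = i (k + 1) := by
    intro n k
    induction n with
    | zero => intro h; rwa [Nat.zero_add] at h
    | succ n ih =>
      intro h
      apply ih
      rw [← hpeel n, h, Nat.add_right_comm, hpeel]
  obtain ⟨k, hk⟩ : ∃ k, i 0 = i (k + 1) := by
    obtain ⟨m, n, hmn, h⟩ := Finite.exists_ne_map_eq_of_infinite
      (fun n => (⟨i n, hidem n⟩ : IdemE T))
    have h' : i m = i n := congrArg Subtype.val h
    rcases lt_or_gt_of_ne hmn with hlt | hlt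
    · obtain ⟨k, rfl⟩ := Nat.exists_eq_add_of_lt hlt
      exact ⟨k, hne m k h'⟩
    · obtain ⟨k, rfl⟩ := Nat.exists_eq_add_of_lt hlt
      exact ⟨k, hne n k h'.symm⟩
  have hw : e = Y * (i k * X) := by rw [← mul_assoc, ← is, ← hk, i0]
  have hX : X = i k * X := by
    calc X = X * (Y * (i k * X)) := by rw [← hw, hXe]
      _ = (X * Y) * i k * X := by simp only [mul_assoc]
      _ = i k * X := by rw [hXY, hei]
  rw [hX, ← hw]

/-- If `r` and all its translates meet only finitely many 𝓡-classes, then `r * z 𝓛 r`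
forces `r * z 𝓡 r`. -/
theorem exists_mul_eq_of_finite_greenR {ι : Type*} [Finite ι] (g : ι → T)
    (hg : ∀ a : T, IsRegularElem a → ∃ j, GreenR a (g j))
    {r u w z : T} (hr : IsRegularElem r) (hw : w * r = r * z) (hu : u * (r * z) = r) :
    GreenR (r * z) r := by
  let q : ℕ → T := fun n => Nat.rec r (fun _ t => w * t) n
  have qs : ∀ n, q (n + 1) = w * q n := fun _ => rfl
  have qz : ∀ n, q (n + 1) = q n * z := by
    intro n
    induction n with
    | zero => exact hw
    | succ n ih => rw [qs (n + 1), ih, ← mul_assoc, ← qs, ih]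
  have qu : ∀ n, u * q (n + 1) = q n := by
    intro n
    induction n with
    | zero => rw [qz]; exact hu
    | succ n ih => rw [qz (n + 1), ← mul_assoc, ih, qz]
  have qreg : ∀ n, IsRegularElem (q n) := by
    intro n
    induction n with
    | zero => exact hr
    | succ n ih =>
      obtain ⟨d, hd⟩ := ih
      refine ⟨d * u, ?_⟩
      calc q (n + 1) * (d * u) * q (n + 1) = w * (q n * d * (u * q (n + 1))) := by
            simp only [qs, mul_assoc]
        _ = q (n + 1) := by rw [qu, hd, qs]
  choose j hj using fun n => hg (q n) (qreg n)
  have hne : ∀ n k, GreenR (q n) (q (n + (k + 1))) → GreenR (q 0) (q (k + 1)) := by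
    intro n k
    induction n with
    | zero => intro h; rwa [Nat.zero_add] at h
    | succ n ih =>
      intro h
      apply ih
      have := h.mul_left u
      rwa [qu, Nat.add_right_comm, qu] at this
  obtain ⟨k, hk⟩ : ∃ k, GreenR (q 0) (q (k + 1)) := by
    obtain ⟨m, n, hmn, h⟩ := Finite.exists_ne_map_eq_of_infinite j
    have hR : GreenR (q m) (q n) := (hj m).trans (h ▸ (hj n).symm)
    rcases lt_or_gt_of_ne hmn with hlt | hlt
    · obtain ⟨k, rfl⟩ := Nat.exists_eq_add_of_lt hlt
      exact ⟨k, hne m k hR⟩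
    · obtain ⟨k, rfl⟩ := Nat.exists_eq_add_of_lt hlt
      exact ⟨k, hne n k hR.symm⟩
  have hle : ∀ n, q (n + 1) = r * z ∨ ∃ t, q (n + 1) = r * z * t := by
    intro n
    induction n with
    | zero => exact Or.inl (qz 0)
    | succ n ih =>
      rcases ih with h | ⟨t, h⟩
      · exact Or.inr ⟨z, by rw [qz (n + 1), h]⟩
      · exact Or.inr ⟨t * z, by rw [qz (n + 1), h, mul_assoc]⟩
  rcases hk with h | ⟨-, y, -, hy⟩
  · rcases hle k with h' | ⟨t, h'⟩
    · exact Or.inl (h'.symm.trans h.symm)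
    · exact Or.inr ⟨t, z, (h'.symm.trans h.symm), rfl⟩
  · rcases hle k with h' | ⟨t, h'⟩
    · exact Or.inr ⟨y, z, by rw [← h']; exact hy, rfl⟩
    · exact Or.inr ⟨t * y, z, by rw [← mul_assoc, ← h']; exact hy, rfl⟩

end GreenLemmas

section IGlemmas

variable {S : Type*} [Semigroup S]

/-- The value in `S` of a word over `E`. -/
def wordVal : FreeSemigroup (IdemE S) →ₙ* S := FreeSemigroup.lift Subtype.val

theorem wordVal_of (e : IdemE S) : wordVal (FreeSemigroup.of e) = (e : S) :=
  FreeSemigroup.lift_of _ _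

theorem igBar_mul (u v : FreeSemigroup (IdemE S)) : igBar (u * v) = igBar u * igBar v := rfl

theorem igBar_surjective (p : IG S) : ∃ w, igBar w = p := Quotient.exists_rep p

theorem igBar_eq_iff {u v : FreeSemigroup (IdemE S)} : igBar u = igBar v ↔ igCon S u v :=
  Con.eq _

theorem mulHom_eq_of_igBar_eq {M : Type*} [Mul M] (F : FreeSemigroup (IdemE S) →ₙ* M)
    (hF : ∀ u v, igRelBase u v → F u = F v) {u v : FreeSemigroup (IdemE S)}
    (h : igBar u = igBar v) : F u = F v := by
  have hle : igCon S ≤ Con.ker F := Con.conGen_le.2 fun u v huv => hF u v huv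
  exact hle (igBar_eq_iff.1 h)

theorem wordVal_eq_of_igBar_eq {u v : FreeSemigroup (IdemE S)} (h : igBar u = igBar v) :
    wordVal u = wordVal v := by
  refine mulHom_eq_of_igBar_eq wordVal ?_ h
  rintro _ _ ⟨e, f, g, -, hg, rfl, rfl⟩
  rw [map_mul, wordVal_of, wordVal_of, wordVal_of, hg]

theorem igBar_mul_of_basicPair {e f g : IdemE S} (h : BasicPair e f) (hg : (e : S) * f = g) :
    igBar (FreeSemigroup.of e) * igBar (FreeSemigroup.of f) = igBar (FreeSemigroup.of g) := by
  rw [← igBar_mul, igBar_eq_iff]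
  exact ConGen.Rel.of _ _ ⟨e, f, g, h, hg.symm, rfl, rfl⟩

/-- If `xe 𝓛 e` in `S`, then `x̄ē` is 𝓡-related to a letter in IG(E). -/
theorem exists_greenR_of_mul_of {x e : IdemE S} {y : S} (hy : y * (x * e) = (e : S)) :
    ∃ g : IdemE S, GreenR (igBar (FreeSemigroup.of x) * igBar (FreeSemigroup.of e))
      (igBar (FreeSemigroup.of g)) := by
  have hee := e.2
  have hxx := x.2
  have hid : (e * (y * x) : S) * (e * (y * x)) = e * (y * x) := by
    calc (e * (y * x) : S) * (e * (y * x)) = e * (y * (x * e)) * (y * x) := by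
          simp only [mul_assoc]
      _ = e * (y * x) := by rw [hy, hee]
  let e' : IdemE S := ⟨e * (y * x), hid⟩
  have h1 : (e' : S) * e = e := by
    change (e * (y * x) : S) * e = e
    rw [mul_assoc, mul_assoc, hy, hee]
  have h2 : (e : S) * e' = e' := by
    change (e : S) * (e * (y * x)) = e * (y * x)
    rw [← mul_assoc, hee]
  have h3 : (e' : S) * x = e' := by
    change (e * (y * x) : S) * x = e * (y * x)
    rw [mul_assoc, mul_assoc, hxx]
  let g : IdemE S := ⟨x * e', by rw [mul_assoc, ← mul_assoc (e' : S), h3, e'.2]⟩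
  have k1 := igBar_mul_of_basicPair (Or.inr (Or.inl h1)) h1
  have k2 := igBar_mul_of_basicPair (Or.inr (Or.inl h2)) h2
  have k3 : _ = igBar (FreeSemigroup.of g) :=
    igBar_mul_of_basicPair (e := x) (f := e') (Or.inr (Or.inr (Or.inr h3))) rfl
  refine ⟨g, Or.inr ⟨igBar (FreeSemigroup.of e'), igBar (FreeSemigroup.of e), ?_, ?_⟩⟩
  · rw [mul_assoc, k2, k3]
  · rw [← k3, mul_assoc, k1]

theorem exists_greenR_mul_of (w : FreeSemigroup (IdemE S)) :
    ∀ {e : IdemE S} {y : S}, y * (wordVal w * e) = (e : S) →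
      ∃ g : IdemE S, GreenR (igBar w * igBar (FreeSemigroup.of e))
        (igBar (FreeSemigroup.of g)) := by
  induction w using FreeSemigroup.recOnMul with
  | ih1 x =>
    intro e y hy
    rw [wordVal_of] at hy
    exact exists_greenR_of_mul_of hy
  | ih2 x w _ ih =>
    intro e y hy
    rw [map_mul, wordVal_of] at hy
    obtain ⟨g, hg⟩ := ih (e := e) (y := y * x) (by simpa only [mul_assoc] using hy)
    obtain ⟨t, ht⟩ : ∃ t : S, wordVal w * e * t = g := by
      rcases hg with h | ⟨t, -, h, -⟩
      · have := wordVal_eq_of_igBar_eq (u := w * FreeSemigroup.of e) h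
        rw [map_mul, wordVal_of, wordVal_of] at this
        exact ⟨e, by rw [mul_assoc, e.2, this]⟩
      · obtain ⟨t, rfl⟩ := igBar_surjective t
        have := wordVal_eq_of_igBar_eq (u := w * FreeSemigroup.of e * t) h
        rw [map_mul, map_mul, wordVal_of, wordVal_of] at this
        exact ⟨_, this⟩
    obtain ⟨k, hk⟩ := exists_greenR_of_mul_of (x := x) (e := g) (y := wordVal w * e * y) (by
      calc wordVal w * e * y * (x * g) = wordVal w * e * (y * (x * wordVal w * e)) * t := by
            rw [← ht]; simp only [mul_assoc]
        _ = g := by rw [hy, mul_assoc (wordVal w), e.2, ht])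
    refine ⟨k, GreenR.trans ?_ hk⟩
    rw [igBar_mul, mul_assoc]
    exact hg.mul_left _

theorem exists_of_mul_mul_eq (w : FreeSemigroup (IdemE S)) :
    ∀ {e : IdemE S} {y : S}, (e * wordVal w) * y = (e : S) →
      ∃ t : IG S, igBar (FreeSemigroup.of e) * igBar w * t = igBar (FreeSemigroup.of e) := by
  have key : ∀ {x e : IdemE S} {y : S}, e * x * y = (e : S) → ∃ e' g : IdemE S,
      (g : S) = x * y * e * x ∧
      igBar (FreeSemigroup.of e) * igBar (FreeSemigroup.of x) =
        igBar (FreeSemigroup.of e) * igBar (FreeSemigroup.of g) ∧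
      igBar (FreeSemigroup.of e) * igBar (FreeSemigroup.of x) * igBar (FreeSemigroup.of e') =
        igBar (FreeSemigroup.of e) := by
    intro x e y hy
    have hee := e.2
    have hxx := x.2
    have hid : (x * y * e : S) * (x * y * e) = x * y * e := by
      calc (x * y * e : S) * (x * y * e) = x * y * (e * x * y) * e := by
            simp only [mul_assoc]
        _ = x * y * e := by rw [hy, mul_assoc, hee]
    let e' : IdemE S := ⟨x * y * e, hid⟩
    have h1 : (e : S) * e' = e := by
      change (e : S) * (x * y * e) = e
      rw [← mul_assoc, ← mul_assoc, hy, hee]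
    have h3 : (x : S) * e' = e' := by
      change (x : S) * (x * y * e) = x * y * e
      rw [← mul_assoc, ← mul_assoc, hxx]
    let g : IdemE S := ⟨e' * x, by rw [mul_assoc, ← mul_assoc (x : S), h3, ← mul_assoc, e'.2]⟩
    have k1 := igBar_mul_of_basicPair (Or.inl h1) h1
    have k2 := igBar_mul_of_basicPair (Or.inr (Or.inl h3)) h3
    have k3 : _ = igBar (FreeSemigroup.of g) :=
      igBar_mul_of_basicPair (e := e') (f := x) (Or.inr (Or.inr (Or.inl h3))) rfl
    refine ⟨e', g, rfl, ?_, ?_⟩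
    · rw [← k3, ← mul_assoc, k1]
    · rw [mul_assoc, k2, k1]
  induction w using FreeSemigroup.recOnMul with
  | ih1 x =>
    intro e y hy
    rw [wordVal_of] at hy
    obtain ⟨e', -, -, -, h⟩ := key hy
    exact ⟨_, h⟩
  | ih2 x w _ ih =>
    intro e y hy
    rw [map_mul, wordVal_of] at hy
    obtain ⟨e', g, hg, h1, h2⟩ := key (x := x) (e := e) (y := wordVal w * y)
      (by simpa only [mul_assoc] using hy)
    obtain ⟨t, ht⟩ := ih (e := g) (y := y * e * x) (by
      calc (g : S) * wordVal w * (y * e * x)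
          = x * (wordVal w * y) * (e * (x * wordVal w) * y) * e * x := by
            rw [hg]; simp only [mul_assoc]
        _ = g := by rw [hy, hg]; simp only [mul_assoc]; rw [← mul_assoc (e : S) e, e.2])
    refine ⟨t * igBar (FreeSemigroup.of e'), ?_⟩
    calc igBar (FreeSemigroup.of e) * igBar (FreeSemigroup.of x * w) *
          (t * igBar (FreeSemigroup.of e'))
        = igBar (FreeSemigroup.of e) * igBar (FreeSemigroup.of x) * igBar w * t *
          igBar (FreeSemigroup.of e') := by rw [igBar_mul]; simp only [mul_assoc]
      _ = igBar (FreeSemigroup.of e) * (igBar (FreeSemigroup.of g) * igBar w * t) *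
          igBar (FreeSemigroup.of e') := by rw [h1]; simp only [mul_assoc]
      _ = igBar (FreeSemigroup.of e) := by rw [ht, ← h1, h2]

/-- The ideal `S f S`. -/
def sandwichIdeal (f : S) : Set S := {t | ∃ u v, u * f * v = t}

theorem mul_left_mem_sandwichIdeal {f t : S} (s : S) (h : t ∈ sandwichIdeal f) :
    s * t ∈ sandwichIdeal f := by
  obtain ⟨u, v, rfl⟩ := h
  exact ⟨s * u, v, by simp only [mul_assoc]⟩

theorem mul_right_mem_sandwichIdeal {f t : S} (s : S) (h : t ∈ sandwichIdeal f) :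
    t * s ∈ sandwichIdeal f := by
  obtain ⟨u, v, rfl⟩ := h
  exact ⟨u, v * s, by simp only [mul_assoc]⟩

/-- The right ideals of `S` containing `S f S`. -/
abbrev RightIdealOver (f : S) : Type _ :=
  {R : Set S // sandwichIdeal f ⊆ R ∧ ∀ r ∈ R, ∀ s, r * s ∈ R}

/-- The right ideal `S f S` itself. -/
def baseIdeal (f : S) : RightIdealOver f :=
  ⟨sandwichIdeal f, subset_rfl, fun _ hr s => mul_right_mem_sandwichIdeal s hr⟩

/-- The right ideal `{t | x t ∈ R}`. -/
def residualIdeal {f : S} (x : S) (R : RightIdealOver f) : RightIdealOver f :=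
  ⟨{t | x * t ∈ R.1}, fun _ ht => R.2.1 (mul_left_mem_sandwichIdeal x ht),
    fun r hr s => by
      change x * (r * s) ∈ R.1
      rw [← mul_assoc]
      exact R.2.2 _ hr s⟩

theorem residualIdeal_mul {f : S} (x y : S) (R : RightIdealOver f) :
    residualIdeal (x * y) R = residualIdeal y (residualIdeal x R) :=
  Subtype.ext (Set.ext fun t => by
    change x * y * t ∈ R.1 ↔ x * (y * t) ∈ R.1
    rw [mul_assoc])

open Classical in
/-- One step of an automaton which greedily counts, from left to right, the consecutive
factors of a word (overlapping in their end letters) whose values lie in `S f S`, and which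
fails at letters from `S f S`. -/
noncomputable def countStep (f : S) (x : IdemE S) (q : ℕ × RightIdealOver f) :
    Option (ℕ × RightIdealOver f) :=
  if (x : S) ∈ sandwichIdeal f then none
  else if (x : S) ∈ q.2.1 then some (q.1 + 1, residualIdeal x (baseIdeal f))
  else some (q.1, residualIdeal x q.2)

/-- The action of words on the states of the counting automaton. -/
noncomputable def countRun (f : S) :
    FreeSemigroup (IdemE S) →ₙ* (Function.End (Option (ℕ × RightIdealOver f)))ᵐᵒᵖ :=
  FreeSemigroup.lift fun x => MulOpposite.op fun o => o.bind (countStep f x)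

theorem countRun_of (f : S) (x : IdemE S) (o : Option (ℕ × RightIdealOver f)) :
    (countRun f (FreeSemigroup.of x)).unop o = o.bind (countStep f x) := by
  rw [countRun, FreeSemigroup.lift_of]
  rfl

theorem countRun_mul (f : S) (u v : FreeSemigroup (IdemE S))
    (o : Option (ℕ × RightIdealOver f)) :
    (countRun f (u * v)).unop o = (countRun f v).unop ((countRun f u).unop o) := by
  rw [map_mul]
  rfl

theorem countStep_bind (f : S) {x y g : IdemE S} (h : BasicPair x y)
    (hg : (g : S) = x * y) (q : ℕ × RightIdealOver f) :
    (countStep f x q).bind (countStep f y) = countStep f g q := by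
  obtain ⟨k, R⟩ := q
  have hxx := x.2
  have hyy := y.2
  by_cases hx : (x : S) ∈ sandwichIdeal f
  · have hgI : (g : S) ∈ sandwichIdeal f := hg ▸ mul_right_mem_sandwichIdeal _ hx
    simp [countStep, hx, hgI]
  by_cases hy : (y : S) ∈ sandwichIdeal f
  · have hgI : (g : S) ∈ sandwichIdeal f := hg ▸ mul_left_mem_sandwichIdeal _ hy
    by_cases hxR : (x : S) ∈ R.1 <;> simp [countStep, hx, hy, hgI, hxR]
  have hgI : (x * y : S) ∉ sandwichIdeal f := by
    intro hI
    rcases h with h | h | h | h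
    · exact hx (h ▸ hI)
    · exact hy (h ▸ hI)
    · apply hx
      rw [← hxx]
      nth_rewrite 2 [← h]
      rw [← mul_assoc]
      exact mul_right_mem_sandwichIdeal _ hI
    · apply hy
      rw [← hyy]
      nth_rewrite 1 [← h]
      rw [mul_assoc]
      exact mul_left_mem_sandwichIdeal _ hI
  have hres : ∀ Q : RightIdealOver f, (y : S) ∈ (residualIdeal (x : S) Q).1 ↔ (x * y : S) ∈ Q.1 :=
    fun _ => Iff.rfl
  have hbase : (x * y : S) ∉ (baseIdeal f).1 := hgI
  by_cases hxR : (x : S) ∈ R.1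
  · have hgR : (x * y : S) ∈ R.1 := R.2.2 _ hxR _
    simp [countStep, hx, hy, hg, hgI, hxR, hgR, hres, hbase, residualIdeal_mul]
  by_cases hgR : (x * y : S) ∈ R.1
  · have key : residualIdeal (y : S) (baseIdeal f) = residualIdeal (x * y : S) (baseIdeal f) := by
      rcases h with h | h | h | h
      · exact absurd (h ▸ hgR) hxR
      · rw [h]
      · refine absurd ?_ hxR
        have := R.2.2 _ hgR x
        rwa [mul_assoc, h, hxx] at this
      · refine Subtype.ext (Set.ext fun t => ⟨fun ht => ?_, fun ht => ?_⟩)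
        · change (x * y * t : S) ∈ sandwichIdeal f
          rw [mul_assoc]
          exact mul_left_mem_sandwichIdeal _ ht
        · change (y * t : S) ∈ sandwichIdeal f
          have := mul_left_mem_sandwichIdeal (y : S) (show (x * y * t : S) ∈ _ from ht)
          rwa [← mul_assoc, ← mul_assoc, h, hyy] at this
    simp [countStep, hx, hy, hg, hgI, hxR, hgR, hres, key]
  · simp [countStep, hx, hy, hg, hgI, hxR, hgR, hres, residualIdeal_mul]

theorem countRun_eq_of_igBar_eq (f : S) {u v : FreeSemigroup (IdemE S)}
    (h : igBar u = igBar v) : countRun f u = countRun f v := by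
  refine mulHom_eq_of_igBar_eq (countRun f) ?_ h
  rintro _ _ ⟨x, y, g, hb, hg, rfl, rfl⟩
  apply MulOpposite.unop_injective
  funext o
  rw [countRun_mul, countRun_of, countRun_of, countRun_of]
  cases o with
  | none => rfl
  | some q => exact countStep_bind f hb hg q

theorem countRun_some (f : S) (w : FreeSemigroup (IdemE S)) :
    ∀ q q' : ℕ × RightIdealOver f, (countRun f w).unop (some q) = some q' →
      q.1 ≤ q'.1 ∧ (q'.1 = q.1 → wordVal w ∉ q.2.1 ∧ q'.2 = residualIdeal (wordVal w) q.2) := by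
  have letter : ∀ (x : IdemE S) (q q' : ℕ × RightIdealOver f), countStep f x q = some q' →
      q.1 ≤ q'.1 ∧ (q'.1 = q.1 → (x : S) ∉ q.2.1 ∧ q'.2 = residualIdeal (x : S) q.2) := by
    intro x q q' h
    unfold countStep at h
    split_ifs at h with h1 h2
    · obtain rfl := Option.some.inj h
      exact ⟨Nat.le_succ _, fun h => absurd h (Nat.succ_ne_self _)⟩
    · obtain rfl := Option.some.inj h
      exact ⟨le_rfl, fun _ => ⟨h2, rfl⟩⟩
  induction w using FreeSemigroup.recOnMul with
  | ih1 x =>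
    intro q q' h
    rw [countRun_of] at h
    rw [wordVal_of]
    exact letter x q q' h
  | ih2 x w _ ih =>
    intro q q' h
    rw [countRun_mul, countRun_of, Option.bind_some] at h
    cases hq : countStep f x q with
    | none =>
      exfalso
      have hnone : ∀ v : FreeSemigroup (IdemE S), (countRun f v).unop none = none := by
        intro v
        induction v using FreeSemigroup.recOnMul with
        | ih1 y => rw [countRun_of]; rfl
        | ih2 y v _ ih' => rw [countRun_mul, countRun_of, Option.bind_none, ih']
      rw [hq, hnone] at h
      cases h
    | some q₁ =>
      rw [hq] at h
      obtain ⟨l1, e1⟩ := letter x q q₁ hq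
      obtain ⟨l2, e2⟩ := ih q₁ q' h
      refine ⟨l1.trans l2, fun heq => ?_⟩
      obtain ⟨-, r1⟩ := e1 (by omega)
      obtain ⟨n2, r2⟩ := e2 (by omega)
      rw [r1] at n2 r2
      rw [map_mul, wordVal_of, residualIdeal_mul]
      exact ⟨n2, r2⟩

theorem exists_letter_of_countRun_none (f : S) (w : FreeSemigroup (IdemE S)) :
    ∀ q : ℕ × RightIdealOver f, (countRun f w).unop (some q) = none →
      ∃ e : IdemE S, (e : S) ∈ sandwichIdeal f ∧
        ∀ x y : IG S, ∃ a b : IG S, x * igBar w * y = a * igBar (FreeSemigroup.of e) * b := by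
  have letter : ∀ (x : IdemE S) (q : ℕ × RightIdealOver f), countStep f x q = none →
      (x : S) ∈ sandwichIdeal f := by
    intro x q h
    unfold countStep at h
    split_ifs at h with h1
    exact h1
  induction w using FreeSemigroup.recOnMul with
  | ih1 x =>
    intro q h
    rw [countRun_of] at h
    exact ⟨x, letter x q h, fun a b => ⟨a, b, rfl⟩⟩
  | ih2 x w _ ih =>
    intro q h
    rw [countRun_mul, countRun_of, Option.bind_some] at h
    cases hq : countStep f x q with
    | none =>
      exact ⟨x, letter x q hq, fun a b => ⟨a, igBar w * b, by
        rw [igBar_mul]; simp only [mul_assoc]⟩⟩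
    | some q₁ =>
      rw [hq] at h
      obtain ⟨e, he, hab⟩ := ih q₁ h
      refine ⟨e, he, fun a b => ?_⟩
      obtain ⟨c, d, hcd⟩ := hab (a * igBar (FreeSemigroup.of x)) b
      exact ⟨c, d, by rw [← hcd, igBar_mul]; simp only [mul_assoc]⟩

/-- Every word representing an idempotent with value `f` has a letter in `S f S`. -/
theorem exists_letter_of_idempotent {w : FreeSemigroup (IdemE S)}
    (hw : igBar w * igBar w = igBar w) :
    ∃ e : IdemE S, (e : S) ∈ sandwichIdeal (wordVal w) ∧
      ∃ a b : IG S, igBar w = a * igBar (FreeSemigroup.of e) * b := by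
  have hrun : (countRun (wordVal w) w).unop (some (0, baseIdeal _)) = none := by
    by_contra hne
    obtain ⟨q, hq⟩ := Option.ne_none_iff_exists'.1 hne
    have hq2 : (countRun (wordVal w) w).unop (some q) = some q := by
      have h := countRun_mul (wordVal w) w w (some (0, baseIdeal _))
      rw [countRun_eq_of_igBar_eq (u := w * w) (v := w) _ hw, hq] at h
      exact h.symm
    have hval : wordVal w * wordVal w = wordVal w := by
      rw [← map_mul]
      exact wordVal_eq_of_igBar_eq hw
    refine ((countRun_some _ w q q hq2).2 rfl).1 (q.2.2.1 ⟨wordVal w, wordVal w, ?_⟩)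
    rw [hval, hval]
  obtain ⟨e, he, hab⟩ := exists_letter_of_countRun_none _ _ _ hrun
  obtain ⟨a, b, h⟩ := hab (igBar w) (igBar w)
  exact ⟨e, he, a, b, by rw [← h, hw, hw]⟩

theorem exists_greenR_of_idempotent [Finite (IdemE S)] {p : IG S} (hp : p * p = p) :
    ∃ g : IdemE S, GreenR p (igBar (FreeSemigroup.of g)) := by
  obtain ⟨w, rfl⟩ := igBar_surjective p
  obtain ⟨e, ⟨u, v, huv⟩, a, b, hab⟩ := exists_letter_of_idempotent hp
  obtain ⟨a, rfl⟩ := igBar_surjective a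
  obtain ⟨b, rfl⟩ := igBar_surjective b
  have hee := e.2
  have hval : wordVal w = wordVal a * e * wordVal b := by
    have := wordVal_eq_of_igBar_eq (v := a * FreeSemigroup.of e * b) hab
    rwa [map_mul, map_mul, wordVal_of] at this
  have he : (e : S) = u * (wordVal a * e * wordVal b) * v := by rw [← hval, huv]
  have hYX : (e * (wordVal b * v * e) : S) * (e * (u * wordVal a * e)) = e := by
    apply mul_eq_idempotent_comm hee
    · simp only [mul_assoc, hee]
    · rw [← mul_assoc, hee]
    · calc (e * (u * wordVal a * e) : S) * (e * (wordVal b * v * e))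
          = e * (u * (wordVal a * (e * e) * wordVal b) * v) * e := by simp only [mul_assoc]
        _ = e := by rw [hee, ← he, hee, hee]
  obtain ⟨g, hg⟩ := exists_greenR_mul_of a (e := e)
    (y := e * (wordVal b * v * e) * (e * u)) (by
      simpa only [mul_assoc] using hYX)
  obtain ⟨t, ht⟩ := exists_of_mul_mul_eq b (e := e)
    (y := v * e * (e * (u * wordVal a * e))) (by
      simpa only [mul_assoc] using hYX)
  refine ⟨g, GreenR.trans ?_ hg⟩
  refine Or.inr ⟨t, igBar b, ?_, hab.symm⟩
  rw [hab, mul_assoc, mul_assoc, ← mul_assoc (igBar (FreeSemigroup.of e)), ht]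

theorem exists_greenR_of_isRegularElem [Finite (IdemE S)] {a : IG S} (ha : IsRegularElem a) :
    ∃ g : IdemE S, GreenR a (igBar (FreeSemigroup.of g)) := by
  obtain ⟨b, hb⟩ := ha
  obtain ⟨g, hg⟩ := exists_greenR_of_idempotent (p := a * b) (by rw [← mul_assoc, hb])
  exact ⟨g, GreenR.trans (Or.inr ⟨b, a, rfl, hb⟩) hg⟩

end IGlemmas

theorem stmt7 {S : Type*} [Semigroup S] [Finite (IdemE S)]
    (r : IG S) (hreg : ∃ ε : IG S, ε * ε = ε ∧ GreenD r ε)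
    (e : IdemE S) (hre : GreenD r (r * igBar (FreeSemigroup.of e))) :
    GreenR (r * igBar (FreeSemigroup.of e)) r ∧
    ∀ s : IG S, GreenD r s → GreenL s r →
      GreenD r (s * igBar (FreeSemigroup.of e)) ∧
      GreenR (s * igBar (FreeSemigroup.of e)) s ∧
      GreenL (s * igBar (FreeSemigroup.of e)) (r * igBar (FreeSemigroup.of e)) := by
  set x := igBar (FreeSemigroup.of e)
  have hr := (hreg.elim fun _ h => IsRegularElem.of_greenD_idempotent h.1 h.2)
  have main : GreenR (r * x) r := by
    obtain ⟨c, hrc, hcx⟩ := hre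
    rcases hcx with rfl | ⟨w, u, hw, hu⟩
    · exact hrc.symm
    rcases hrc with rfl | ⟨-, y, -, hy⟩
    · exact exists_mul_eq_of_finite_greenR _ (fun _ h => exists_greenR_of_isRegularElem h)
        hr hw hu
    · have h : GreenR (r * (x * y)) r :=
        exists_mul_eq_of_finite_greenR _ (fun _ h => exists_greenR_of_isRegularElem h)
          (u := u) (w := w) hr (by rw [← hy, ← mul_assoc, hw, hy, mul_assoc])
          (by rw [← mul_assoc, ← mul_assoc, mul_assoc u, hu, hy])
      rcases h with h | ⟨t, -, h, -⟩
      · exact Or.inr ⟨y, x, by rw [mul_assoc, h], rfl⟩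
      · exact Or.inr ⟨y * t, x, by simpa only [mul_assoc] using h, rfl⟩
  refine ⟨main, fun s _ hs => ?_⟩
  have hL : GreenL (s * x) (r * x) := hs.mul_right x
  refine ⟨⟨r * x, main.symm, hL.symm⟩, ?_, hL⟩
  rcases hs with rfl | ⟨-, z, -, rfl⟩
  · exact main
  · rw [mul_assoc]
    exact main.mul_left z
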